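/- The complete graph K₃ (a triangle) admits no identical biarithmetic IASI. Equivalently, there do not exist positive integers d₁, d₂, d₃ and an integer k > 1 such that for every pair i ≠ j in {1,2,3} one has d_i = k·d_j or d_j = k·d_i. -/

import Mathlib

open Pointwise

/-- A finite set of naturals is a `d`-AP-set if `d > 0`, it has at least 3 elements,
and its elements form an arithmetic progression with common difference `d`. -/
def IsAPSet (d : ℕ) (A : Finset ℕ) : Prop :=
  0 < d ∧ 3 ≤ A.card ∧ ∃ a : ℕ, A = (Finset.range A.card).image (fun i => a + i * d)

/-- An integer additive set-indexer (IASI) of a simple graph `G`: an injective labeling of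
vertices by nonempty finite sets of naturals whose induced edge labeling
`f⁺(uv) = f(u) + f(v)` (sumset) is injective on edges. -/
structure IsIASI {V : Type*} (G : SimpleGraph V) (f : V → Finset ℕ) : Prop where
  injective : Function.Injective f
  nonempty : ∀ v, (f v).Nonempty
  edgeInjective : ∀ ⦃u v x y : V⦄, G.Adj u v → G.Adj x y →
    f u + f v = f x + f y → s(u, v) = s(x, y)

/-- A biarithmetic IASI of `G`: an IASI whose vertex labels are AP-sets with deterministic
indices `dv`, whose edge labels are AP-sets, and such that on each edge one deterministic
index is `k` times the other for some integer `k > 1` with `k` at most the cardinality of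
the label of the vertex with the smaller index. -/
def IsBiarithmeticIASI {V : Type*} (G : SimpleGraph V) (f : V → Finset ℕ)
    (dv : V → ℕ) : Prop :=
  IsIASI G f ∧ (∀ v, IsAPSet (dv v) (f v)) ∧
    (∀ u v, G.Adj u v → ∃ δ, IsAPSet δ (f u + f v)) ∧
    (∀ u v, G.Adj u v → ∃ k : ℕ, 1 < k ∧
      ((dv v = k * dv u ∧ k ≤ (f u).card) ∨ (dv u = k * dv v ∧ k ≤ (f v).card)))

/-- An identical biarithmetic IASI of `G` with multiplier `k`: a biarithmetic IASI in which
the same integer `k > 1` works for every edge. -/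
def IsIdenticalBiarithmeticIASI {V : Type*} (G : SimpleGraph V) (f : V → Finset ℕ)
    (dv : V → ℕ) (k : ℕ) : Prop :=
  IsIASI G f ∧ 1 < k ∧ (∀ v, IsAPSet (dv v) (f v)) ∧
    (∀ u v, G.Adj u v → ∃ δ, IsAPSet δ (f u + f v)) ∧
    (∀ u v, G.Adj u v →
      ((dv v = k * dv u ∧ k ≤ (f u).card) ∨ (dv u = k * dv v ∧ k ≤ (f v).card)))

/-- Three positive naturals cannot pairwise differ by the same factor `k > 1`. -/
theorem not_pairwise_differ_by_factor {a b c k : ℕ} (ha : 0 < a) (hb : 0 < b) (hc : 0 < c)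
    (hk : 1 < k) (hab : a = k * b ∨ b = k * a) (hac : a = k * c ∨ c = k * a)
    (hbc : b = k * c ∨ c = k * b) : False := by
  have lt_of_eq_mul : ∀ x y : ℕ, 0 < y → x = k * y → y < x := by
    rintro x y hy rfl
    exact lt_mul_of_one_lt_left hy hk
  have eq_of_mul_eq : ∀ x y : ℕ, k * x = k * y → x = y := fun x y h =>
    Nat.eq_of_mul_eq_mul_left (by omega) h
  grind

/-- The complete graph `K₃` admits no identical biarithmetic IASI; equivalently, there
are no positive integers `d₁, d₂, d₃` and integer `k > 1` such that each pair of them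
differs by the factor `k`. -/
theorem stmt17 :
    (∀ (f : Fin 3 → Finset ℕ) (dv : Fin 3 → ℕ) (k : ℕ),
      ¬ IsIdenticalBiarithmeticIASI (⊤ : SimpleGraph (Fin 3)) f dv k) ∧
    ¬ ∃ (d₁ d₂ d₃ k : ℕ), 0 < d₁ ∧ 0 < d₂ ∧ 0 < d₃ ∧ 1 < k ∧
      (d₁ = k * d₂ ∨ d₂ = k * d₁) ∧ (d₁ = k * d₃ ∨ d₃ = k * d₁) ∧
      (d₂ = k * d₃ ∨ d₃ = k * d₂) := by
  refine ⟨?_, ?_⟩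
  · rintro f dv k ⟨-, hk, hap, -, hadj⟩
    have index_rel : ∀ u v : Fin 3, u ≠ v → dv u = k * dv v ∨ dv v = k * dv u := fun u v h =>
      (hadj u v h).symm.imp And.left And.left
    exact not_pairwise_differ_by_factor (hap 0).1 (hap 1).1 (hap 2).1 hk
      (index_rel 0 1 (by decide)) (index_rel 0 2 (by decide)) (index_rel 1 2 (by decide))
  · rintro ⟨d₁, d₂, d₃, k, h₁, h₂, h₃, hk, h₁₂, h₁₃, h₂₃⟩
    exact not_pairwise_differ_by_factor h₁ h₂ h₃ hk h₁₂ h₁₃ h₂₃
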